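/- For all ω, ξ ∈ Ω with ω ∉ B and ξ ∉ B, one has H(1 ω_{[1,2n]} ξ) → H(1ω) as n → ∞, where 1 ω_{[1,2n]} ξ is the glued configuration equal to 1 at site 0, to ω on sites 1,…,2n, and to ξ on sites > 2n. Consequently, for each ξ_0 ∈ {0,1}, γ_0(ξ_0 | ω_{[1,2n]} ξ_{[2n+1,∞)}) → γ_0(ξ_0 | ω_{[1,∞)}) as n → ∞; i.e. the measure with density exp(−H) with respect to ν is intuitively weakly Gibbs with regular set Ω ∖ B. -/

import Mathlib

open MeasureTheory Filter Topology
open scoped ENNReal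

namespace WeakGibbsExample

/-- Configuration space `Ω = {0,1}^{ℤ≥0}`. -/
abbrev Conf := ℕ → Bool

/-- `ν` is the Bernoulli(1/2,1/2) product measure on `{0,1}^{ℤ≥0}`:
a probability measure giving each cylinder on a finite set `s` measure `2^{-|s|}`. -/
def IsBernoulliHalf (ν : Measure Conf) : Prop :=
  IsProbabilityMeasure ν ∧
    ∀ (s : Finset ℕ) (f : ℕ → Bool),
      ν {ζ | ∀ i ∈ s, ζ i = f i} = (2 : ℝ≥0∞)⁻¹ ^ s.card

/-- `N_m(ω)`: the length of the maximal run of `1`s in `ω` ending at site `m`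
(`0` if `ω m = 0`). -/
def runLen (ω : Conf) (m : ℕ) : ℕ :=
  Nat.findGreatest (fun j => 0 < j ∧ ∀ i < j, ω (m - i) = true) (m + 1)

/-- The potential term `U([0,2p], ω) = ω_0 ω_{2p} ρ^{p - N_{2p}(ω)} 𝟙{N_{2p}(ω) ≤ p}`. -/
noncomputable def U (ρ : ℝ) (ω : Conf) (p : ℕ) : ℝ :=
  if ω 0 = true ∧ ω (2 * p) = true ∧ runLen ω (2 * p) ≤ p then
    ρ ^ (p - runLen ω (2 * p))
  else 0

/-- The Hamiltonian `H(ω) = Σ_{n ≥ 1} U([0,2n], ω) ∈ [0,∞]`. -/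
noncomputable def H (ρ : ℝ) (ω : Conf) : ℝ≥0∞ :=
  ∑' n : ℕ, ENNReal.ofReal (U ρ ω (n + 1))

/-- `B_k = {η : η_j = 1 for all ⌊3k/2⌋ ≤ j ≤ 2k}`. -/
def Bk (k : ℕ) : Set Conf :=
  {η | ∀ j, 3 * k / 2 ≤ j → j ≤ 2 * k → η j = true}

/-- `B = ⋂_K ⋃_{k ≥ K} B_k`. -/
def Bbad : Set Conf :=
  ⋂ K : ℕ, ⋃ k : ℕ, ⋃ _ : K ≤ k, Bk k

/-- `b ζ`: the configuration with symbol `b` at site `0` and agreeing with `ζ` on sites `≥ 1`. -/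
def consb (b : Bool) (ζ : Conf) : Conf := fun i => if i = 0 then b else ζ i

/-- `1ζ`. -/
def one (ζ : Conf) : Conf := consb true ζ

/-- The glued configuration equal to `ω` on `[0,n]` and to `η` on `[n+1,∞)`. -/
def glue (ω η : Conf) (n : ℕ) : Conf := fun i => if i ≤ n then ω i else η i

/-- `γ_0(b | ζ_{[1,∞)})`, the single-site conditional probability computed from the
Hamiltonian (the value of `ζ` at site `0` is ignored). -/
noncomputable def gamma0 (ρ : ℝ) (b : Bool) (ζ : Conf) : ℝ :=
  if b then
    Real.exp (-(H ρ (one ζ)).toReal) / (1 + Real.exp (-(H ρ (one ζ)).toReal))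
  else 1 / (1 + Real.exp (-(H ρ (one ζ)).toReal))

/-- The cylinder `[ω_{[1,n]}] = {ζ : ζ_i = ω_i for 1 ≤ i ≤ n}`. -/
def cylTail (ω : Conf) (n : ℕ) : Set Conf :=
  {ζ | ∀ i, 1 ≤ i → i ≤ n → ζ i = ω i}

/-- `A^ω_{ε,n}`: the set of exterior configurations `η` for which the glued configuration
`ω_{[1,n]} η_{[n+1,∞)}` moves the single-site conditional probabilities by more than `ε`. -/
noncomputable def Abad (ρ : ℝ) (ω : Conf) (ε : ℝ) (n : ℕ) : Set Conf :=
  {η | ∃ b : Bool, ε < |gamma0 ρ b (glue ω η n) - gamma0 ρ b ω|}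

/-- The density `exp(-H(ζ))` (equal to `0` when `H(ζ) = ∞`). -/
noncomputable def expH (ρ : ℝ) (ζ : Conf) : ℝ≥0∞ :=
  if H ρ ζ = ⊤ then 0 else ENNReal.ofReal (Real.exp (-(H ρ ζ).toReal))


lemma runLen_congr {ζ ζ' : Conf} {m : ℕ} (h : ∀ i ≤ m, ζ i = ζ' i) :
    runLen ζ m = runLen ζ' m := by
  have h' : ∀ i, ζ (m - i) = ζ' (m - i) := fun i => h _ (Nat.sub_le _ _)
  simp only [runLen, h']

lemma runLen_le_of_eq_false {ζ : Conf} {m i : ℕ} (hi : i ≤ m) (hζ : ζ i = false) :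
    runLen ζ m ≤ m - i := by
  by_contra! hlt
  have hspec := (Nat.findGreatest_of_ne_zero (P := fun j => 0 < j ∧ ∀ i < j, ζ (m - i) = true)
    (n := m + 1) rfl (by change runLen ζ m ≠ 0; omega)).2 (m - i) hlt
  rw [Nat.sub_sub_self hi, hζ] at hspec
  exact Bool.false_ne_true hspec

lemma U_congr (ρ : ℝ) {ζ ζ' : Conf} {p : ℕ} (h : ∀ i ≤ 2 * p, ζ i = ζ' i) :
    U ρ ζ p = U ρ ζ' p := by
  simp only [U, runLen_congr h, h 0 (Nat.zero_le _), h (2 * p) le_rfl]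

lemma U_nonneg {ρ : ℝ} (hρ : 0 ≤ ρ) (ζ : Conf) (p : ℕ) : 0 ≤ U ρ ζ p := by
  unfold U
  split_ifs
  · positivity
  · exact le_rfl

lemma U_le_one {ρ : ℝ} (hρ : 0 ≤ ρ) (hρ1 : ρ ≤ 1) (ζ : Conf) (p : ℕ) : U ρ ζ p ≤ 1 := by
  unfold U
  split_ifs
  · exact pow_le_one₀ hρ hρ1
  · exact zero_le_one

lemma U_le_pow_of_eq_false {ρ : ℝ} (hρ : 0 ≤ ρ) (hρ1 : ρ ≤ 1) {ζ : Conf} {p i e : ℕ}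
    (hi : i ≤ 2 * p) (hζ : ζ i = false) (he : p + e ≤ i) : U ρ ζ p ≤ ρ ^ e := by
  have hrun := runLen_le_of_eq_false hi hζ
  unfold U
  split_ifs
  · exact pow_le_pow_of_le_one hρ hρ1 (by omega)
  · positivity

lemma exists_eq_false_of_not_mem_Bbad {ω : Conf} (hω : ω ∉ Bbad) :
    ∃ K, ∀ k ≥ K, ∃ j, 3 * k / 2 ≤ j ∧ j ≤ 2 * k ∧ ω j = false := by
  simpa [Bbad, Bk] using hω

lemma one_apply {ζ : Conf} {i : ℕ} (hi : i ≠ 0) : one ζ i = ζ i := by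
  simp [one, consb, hi]

lemma U_one_glue_le {ρ : ℝ} (hρ : 0 ≤ ρ) (hρ1 : ρ ≤ 1) {ω ξ : Conf} {K n : ℕ}
    (hω : ∀ k ≥ K, ∃ j, 3 * k / 2 ≤ j ∧ j ≤ 2 * k ∧ ω j = false)
    (hξ : ∀ k ≥ K, ∃ j, 3 * k / 2 ≤ j ∧ j ≤ 2 * k ∧ ξ j = false) (hn : K ≤ n) (p : ℕ) :
    U ρ (one (glue ω ξ (2 * n))) p ≤ ρ ^ (p / 8 - (K + 1)) := by
  by_cases hp : p / 8 < K + 1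
  · rw [Nat.sub_eq_zero_of_le hp.le, pow_zero]
    exact U_le_one hρ hρ1 _ _
  suffices ∃ i, i ≤ 2 * p ∧ glue ω ξ (2 * n) i = false ∧ p + p / 8 ≤ i by
    obtain ⟨i, hi, hζ, he⟩ := this
    refine U_le_pow_of_eq_false hρ hρ1 hi ?_ (by omega : p + (p / 8 - (K + 1)) ≤ i)
    rwa [one_apply (by omega)]
  rcases le_or_gt p n with hpn | hpn
  · obtain ⟨j, hj, hj', hωj⟩ := hω p (by omega)
    exact ⟨j, hj', by simp [glue, hωj, show j ≤ 2 * n by omega], by omega⟩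
  · obtain ⟨j, hj, hj', hξj⟩ := hξ p (by omega)
    by_cases hjn : j ≤ 2 * n
    · obtain ⟨i, hi, hi', hωi⟩ := hω n hn
      exact ⟨i, by omega, by simp [glue, hωi, hi'], by omega⟩
    · exact ⟨j, hj', by simp [glue, hξj, hjn], by omega⟩

lemma summable_pow_div_sub {ρ : ℝ} (hρ : ρ ∈ Set.Ioo (0 : ℝ) 1) {d : ℕ} (hd : 0 < d) (M : ℕ) :
    Summable fun p : ℕ => ρ ^ (p / d - M) := by
  obtain ⟨hρ0, hρ1⟩ := hρ
  set r : ℝ := ρ ^ ((d : ℝ)⁻¹) with hr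
  have hr0 : 0 < r := Real.rpow_pos_of_pos hρ0 _
  have hr1 : r < 1 := Real.rpow_lt_one hρ0.le hρ1 (by positivity)
  have hrd : r ^ d = ρ := Real.rpow_inv_natCast_pow hρ0.le hd.ne'
  refine Summable.of_nonneg_of_le (fun p => by positivity) (fun p => ?_)
    ((summable_geometric_of_lt_one hr0.le hr1).mul_left (r ^ (d + d * M))⁻¹)
  rw [← hrd, ← pow_mul, le_inv_mul_iff₀ (by positivity), ← pow_add]
  refine pow_le_pow_of_le_one hr0.le hr1.le ?_
  have h₁ : p / d ≤ M + (p / d - M) := le_add_tsub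
  have h₂ := Nat.mul_le_mul_left d h₁
  have h₃ := Nat.div_add_mod p d
  have h₄ := Nat.mod_lt p hd
  rw [Nat.mul_add] at h₂
  omega

lemma H_eq_ofReal_tsum {ρ : ℝ} (hρ : 0 ≤ ρ) {ζ : Conf} (h : Summable fun p => U ρ ζ (p + 1)) :
    H ρ ζ = ENNReal.ofReal (∑' p, U ρ ζ (p + 1)) :=
  (ENNReal.ofReal_tsum_of_nonneg (fun _ => U_nonneg hρ _ _) h).symm

lemma H_one_glue_tendsto {ρ : ℝ} (hρ : ρ ∈ Set.Ioo (0 : ℝ) 1) {ω ξ : Conf}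
    (hω : ω ∉ Bbad) (hξ : ξ ∉ Bbad) :
    H ρ (one ω) ≠ ⊤ ∧
      Tendsto (fun n : ℕ => H ρ (one (glue ω ξ (2 * n)))) atTop (𝓝 (H ρ (one ω))) := by
  obtain ⟨K₁, hK₁⟩ := exists_eq_false_of_not_mem_Bbad hω
  obtain ⟨K₂, hK₂⟩ := exists_eq_false_of_not_mem_Bbad hξ
  obtain ⟨K, hle₁, hle₂⟩ : ∃ K, K₁ ≤ K ∧ K₂ ≤ K := ⟨_, le_max_left _ _, le_max_right _ _⟩
  have hωK : ∀ k ≥ K, ∃ j, 3 * k / 2 ≤ j ∧ j ≤ 2 * k ∧ ω j = false :=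
    fun k hk => hK₁ k (hle₁.trans hk)
  have hξK : ∀ k ≥ K, ∃ j, 3 * k / 2 ≤ j ∧ j ≤ 2 * k ∧ ξ j = false :=
    fun k hk => hK₂ k (hle₂.trans hk)
  have hbound : ∀ {η : Conf}, (∀ k ≥ K, ∃ j, 3 * k / 2 ≤ j ∧ j ≤ 2 * k ∧ η j = false) →
      ∀ n ≥ K, ∀ p, U ρ (one (glue ω η (2 * n))) p ≤ ρ ^ (p / 8 - (K + 1)) :=
    fun hη _ hn p => U_one_glue_le hρ.1.le hρ.2.le hωK hη hn p
  have hsum : Summable fun p : ℕ => ρ ^ ((p + 1) / 8 - (K + 1)) :=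
    (summable_nat_add_iff (f := fun p : ℕ => ρ ^ (p / 8 - (K + 1))) 1).2
      (summable_pow_div_sub hρ (by norm_num) (K + 1))
  have hglue : glue ω ω (2 * K) = ω := by
    funext i
    simp [glue]
  have hH : H ρ (one ω) = ENNReal.ofReal (∑' p, U ρ (one ω) (p + 1)) :=
    H_eq_ofReal_tsum hρ.1.le <| hsum.of_nonneg_of_le (fun _ => U_nonneg hρ.1.le _ _)
      fun p => by simpa only [hglue] using hbound hωK K le_rfl (p + 1)
  refine ⟨hH ▸ ENNReal.ofReal_ne_top, ?_⟩
  rw [hH]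
  have hlim : Tendsto (fun n : ℕ => ∑' p, U ρ (one (glue ω ξ (2 * n))) (p + 1)) atTop
      (𝓝 (∑' p, U ρ (one ω) (p + 1))) := by
    refine tendsto_tsum_of_dominated_convergence hsum (fun p => ?_) ?_
    · refine tendsto_const_nhds.congr' ?_
      filter_upwards [eventually_ge_atTop (p + 1)] with n hn
      refine U_congr ρ fun i hi => ?_
      simp [one, consb, glue, show i ≤ 2 * n by omega]
    · filter_upwards [eventually_ge_atTop K] with n hn p
      rw [Real.norm_of_nonneg (U_nonneg hρ.1.le _ _)]
      exact hbound hξK n hn (p + 1)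
  refine (ENNReal.tendsto_ofReal hlim).congr' ?_
  filter_upwards [eventually_ge_atTop K] with n hn
  exact (H_eq_ofReal_tsum hρ.1.le <| hsum.of_nonneg_of_le (fun _ => U_nonneg hρ.1.le _ _)
    fun p => hbound hξK n hn (p + 1)).symm

/-- For `ω, ξ ∉ B`, `H(1 ω_{[1,2n]} ξ) → H(1ω)` and the single-site
conditional probabilities converge: the measure with density `exp(-H)` w.r.t. `ν` is
intuitively weakly Gibbs with regular set `Ω ∖ B`. -/
theorem H_glue_tendsto_of_not_bad
    (ρ : ℝ) (hρ : ρ ∈ Set.Ioo (0 : ℝ) 1)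
    (ω ξ : Conf) (hω : ω ∉ Bbad) (hξ : ξ ∉ Bbad) :
    Tendsto (fun n : ℕ => H ρ (one (glue ω ξ (2 * n)))) atTop (nhds (H ρ (one ω))) ∧
    ∀ b : Bool,
      Tendsto (fun n : ℕ => gamma0 ρ b (glue ω ξ (2 * n))) atTop (nhds (gamma0 ρ b ω)) := by
  obtain ⟨hfin, hlim⟩ := H_one_glue_tendsto hρ hω hξ
  refine ⟨hlim, fun b => ?_⟩
  have hexp := (Real.continuous_exp.tendsto _).comp ((ENNReal.tendsto_toReal hfin).comp hlim).neg
  have hden := hexp.const_add 1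
  have hne : 1 + Real.exp (-(H ρ (one ω)).toReal) ≠ 0 := by positivity
  cases b
  · simpa [gamma0] using hden.inv₀ hne
  · simpa [gamma0, Pi.div_def] using hexp.div hden hne

end WeakGibbsExample
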